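/- Let $\mathbb{K}$ be a complete noetherian local commutative ring with maximal ideal $\mathfrak{m}$ and residue field $\Bbbk = \mathbb{K}/\mathfrak{m}$. Let $A$ be an $\mathfrak{m}$-adically complete $\mathbb{K}$-algebra, and let $M$ be a perfect complex in $\mathsf{D}(\mathsf{Mod}\,A)$. If $\Bbbk \otimes^{\mathrm{L}}_{\mathbb{K}} M = 0$, then $M = 0$ in $\mathsf{D}(\mathsf{Mod}\,A)$. -/

import Mathlib

universe u

open CategoryTheory Limits

/-- In a bounded above complex of projective modules which is exact in degrees `> n`, the
cycles in degrees `≥ n` are direct summands. -/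
lemma CochainComplex.exists_retraction_cycles {R : Type u} [Ring R]
    (C : CochainComplex (ModuleCat.{u} R) ℤ) (b n : ℤ) (hb : ∀ i, b < i → IsZero (C.X i))
    (hC : ∀ i, Projective (C.X i)) (hn : ∀ i, n < i → C.ExactAt i)
    (i j : ℤ) (hij : (ComplexShape.up ℤ).Rel i j) (hi : n ≤ i) :
    ∃ r : C.X i →ₗ[R] C.X i, (∀ x, C.d i j (r x) = 0) ∧ ∀ x, C.d i j x = 0 → r x = x := by
  obtain ⟨k, hk⟩ : ∃ k : ℕ, b + 1 ≤ i + k := ⟨(b + 1 - i).toNat, by omega⟩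
  induction k generalizing i j with
  | zero =>
    refine ⟨LinearMap.id, fun x ↦ ?_, fun _ _ ↦ rfl⟩
    have := ModuleCat.subsingleton_of_isZero (hb i (by simp at hk; omega))
    rw [Subsingleton.elim (LinearMap.id x) 0, map_zero]
  | succ k ih =>
    obtain rfl : i + 1 = j := hij
    obtain ⟨r, hr, hr'⟩ := ih (i + 1) (i + 1 + 1) rfl (by omega) (by push_cast at hk ⊢; omega)
    have hP : Module.Projective R (C.X (i + 1)) :=
      (IsProjective.iff_projective _).2 (hC _)
    have hex := ((C.exactAt_iff' i (i + 1) (i + 1 + 1) (by simp) (by simp)).1 (hn _ (by omega)))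
    rw [ShortComplex.moduleCat_exact_iff] at hex
    change ∀ x : C.X (i + 1), C.d (i + 1) (i + 1 + 1) x = 0 → ∃ y, C.d i (i + 1) y = x at hex
    let Z := LinearMap.ker (C.d (i + 1) (i + 1 + 1)).hom
    have hZ : Module.Projective R Z := by
      refine Module.Projective.of_split Z.subtype (r.codRestrict Z hr) ?_
      ext x
      exact hr' x x.2
    let δ : C.X i →ₗ[R] Z := (C.d i (i + 1)).hom.codRestrict Z fun x ↦ by
      exact ConcreteCategory.congr_hom (C.d_comp_d i (i + 1) (i + 1 + 1)) x
    have hδ : Function.Surjective δ := fun x ↦ by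
      obtain ⟨y, hy⟩ := hex x x.2
      exact ⟨y, Subtype.ext hy⟩
    obtain ⟨s, hs⟩ := Module.projective_lifting_property δ LinearMap.id hδ
    refine ⟨LinearMap.id - s ∘ₗ δ, fun x ↦ ?_, fun x hx ↦ ?_⟩
    · have h := LinearMap.congr_fun hs (δ x)
      have : δ (x - s (δ x)) = 0 := by rw [map_sub, sub_eq_zero]; exact h.symm
      exact congrArg Subtype.val this
    · have : δ x = 0 := Subtype.ext hx
      simp [this]

lemma CategoryTheory.ShortComplex.moduleCat_homology_finite {R : Type u} [Ring R]
    (S : ShortComplex (ModuleCat.{u} R)) [Module.Finite R S.X₂] (r : S.X₂ →ₗ[R] S.X₂)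
    (hr : ∀ x, S.g (r x) = 0) (hr' : ∀ x, S.g x = 0 → r x = x) :
    Module.Finite R S.homology := by
  have : Module.Finite R (LinearMap.ker S.g.hom) :=
    Module.Finite.of_surjective (r.codRestrict (LinearMap.ker S.g.hom) hr)
      fun x ↦ ⟨x, Subtype.ext (hr' x x.2)⟩
  have : Module.Finite R (LinearMap.ker S.g.hom ⧸ LinearMap.range S.moduleCatToCycles) :=
    inferInstance
  have : Module.Finite R S.moduleCatLeftHomologyData.H := this
  exact Module.Finite.equiv S.moduleCatHomologyIso.symm.toLinearEquiv

section

open scoped ChangeOfRings TensorProduct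

lemma ModuleCat.mem_smul_top_of_one_tmul_residue_eq_zero {K : Type u} [CommRing K]
    [IsLocalRing K] (N : ModuleCat.{u} K) (x : N)
    (hx : ((1 : IsLocalRing.ResidueField K) ⊗ₜ[K, algebraMap K (IsLocalRing.ResidueField K)] x :
      (extendScalars.{u, u} (algebraMap K (IsLocalRing.ResidueField K))).obj N) = 0) :
    x ∈ (IsLocalRing.maximalIdeal K • ⊤ : Submodule K N) := by
  have h := TensorProduct.quotTensorEquivQuotSMul_mk_tmul (IsLocalRing.maximalIdeal K) (1 : K) x
  have h0 : (Ideal.Quotient.mk (IsLocalRing.maximalIdeal K) 1 ⊗ₜ[K] x :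
    TensorProduct K (K ⧸ IsLocalRing.maximalIdeal K) N) = 0 := hx
  rw [h0, map_zero, one_smul] at h
  exact (Submodule.Quotient.mk_eq_zero _).1 h.symm

lemma ModuleCat.exists_one_tmul_residue_eq {K : Type u} [CommRing K]
    [IsLocalRing K] (N : ModuleCat.{u} K)
    (y : (extendScalars.{u, u} (algebraMap K (IsLocalRing.ResidueField K))).obj N) :
    ∃ x : N, ((1 : IsLocalRing.ResidueField K) ⊗ₜ[K, algebraMap K (IsLocalRing.ResidueField K)] x :
      (extendScalars.{u, u} (algebraMap K (IsLocalRing.ResidueField K))).obj N) = y := by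
  exact TensorProduct.mk_surjective K N (IsLocalRing.ResidueField K)
    IsLocalRing.residue_surjective y

lemma CategoryTheory.ShortComplex.homology_le_smul_top {K : Type u} [CommRing K]
    [IsLocalRing K] (S : ShortComplex (ModuleCat.{u} K)) (r : S.X₂ →ₗ[K] S.X₂)
    (hr : ∀ x, S.g (r x) = 0) (hr' : ∀ x, S.g x = 0 → r x = x)
    (hS : (S.map (ModuleCat.extendScalars.{u, u}
      (algebraMap K (IsLocalRing.ResidueField K)))).Exact) (x : S.homology) :
    x ∈ (IsLocalRing.maximalIdeal K • ⊤ : Submodule K S.homology) := by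
  rw [ShortComplex.moduleCat_exact_iff] at hS
  let p : LinearMap.ker S.g.hom →ₗ[K] S.homology :=
    S.moduleCatHomologyIso.symm.toLinearEquiv.toLinearMap ∘ₗ
      (LinearMap.range S.moduleCatToCycles).mkQ
  have hp : Function.Surjective p :=
    S.moduleCatHomologyIso.symm.toLinearEquiv.surjective.comp (Submodule.mkQ_surjective _)
  obtain ⟨z, rfl⟩ := hp x
  obtain ⟨y, hy⟩ := hS ((1 : IsLocalRing.ResidueField K)
    ⊗ₜ[K, algebraMap K (IsLocalRing.ResidueField K)] (z : S.X₂)) (by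
      change (1 : IsLocalRing.ResidueField K)
        ⊗ₜ[K, algebraMap K (IsLocalRing.ResidueField K)] (S.g z.1) = _
      rw [show S.g z.1 = 0 from z.2]
      exact TensorProduct.tmul_zero _ _)
  obtain ⟨y, rfl⟩ := ModuleCat.exists_one_tmul_residue_eq _ y
  have hmem := ModuleCat.mem_smul_top_of_one_tmul_residue_eq_zero S.X₂ (z.1 - S.f y) (by
    refine (TensorProduct.tmul_sub _ _ _).trans (sub_eq_zero.2 hy.symm))
  let ρ : S.X₂ →ₗ[K] LinearMap.ker S.g.hom := r.codRestrict _ hr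
  have hρ : ρ (z.1 - S.f y) = z - S.moduleCatToCycles y := by
    apply Subtype.ext
    exact hr' _ (by rw [map_sub, show S.g z.1 = 0 from z.2, S.moduleCat_zero_apply, sub_zero])
  have hz : p z = (p ∘ₗ ρ) (z.1 - S.f y) := by
    rw [LinearMap.comp_apply, hρ, map_sub, eq_comm, sub_eq_self]
    have : (LinearMap.range S.moduleCatToCycles).mkQ (S.moduleCatToCycles y) = 0 :=
      (Submodule.Quotient.mk_eq_zero _).2 ⟨y, rfl⟩
    exact (congrArg S.moduleCatHomologyIso.symm.toLinearEquiv this).trans (map_zero _)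
  rw [hz]
  exact Submodule.smul_top_le_comap_smul_top _ (p ∘ₗ ρ) hmem

end

lemma IsAdicComplete.exists_mul_one_sub_eq_one {K A : Type*} [CommRing K] (I : Ideal K)
    [Ring A] [Algebra K A] [IsAdicComplete I A] (c : A) (hc : c ∈ (I • ⊤ : Submodule K A)) :
    ∃ z : A, z * (1 - c) = 1 := by
  have hmul : ∀ (n : ℕ) (x : A), x ∈ (I ^ n • ⊤ : Submodule K A) → ∀ y : A,
      x * y ∈ (I ^ n • ⊤ : Submodule K A) := fun n x hx y ↦
    Submodule.smul_top_le_comap_smul_top _ (LinearMap.mulRight K y) hx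
  have hpow : ∀ n : ℕ, c ^ n ∈ (I ^ n • ⊤ : Submodule K A) := fun n ↦ by
    induction n with
    | zero => simp
    | succ n ih =>
      have := Submodule.mem_map_of_mem (f := LinearMap.mulLeft K (c ^ n)) hc
      rw [Submodule.map_smul''] at this
      rw [pow_succ' I, Submodule.mul_smul, pow_succ]
      refine Submodule.smul_mono le_rfl ?_ this
      rintro _ ⟨y, -, rfl⟩
      exact hmul n _ ih y
  obtain ⟨L, hL⟩ := IsPrecomplete.prec (I := I) inferInstance
    (f := fun n ↦ ∑ i ∈ Finset.range n, c ^ i) (by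
      intro m n hmn
      rw [SModEq.comm, SModEq.sub_mem, ← Finset.sum_Ico_eq_sub _ hmn]
      refine Submodule.sum_mem _ fun i hi ↦ ?_
      exact Submodule.smul_mono_left (Ideal.pow_le_pow_right (Finset.mem_Ico.1 hi).1) (hpow i))
  refine ⟨L, sub_eq_zero.1 (IsHausdorff.haus (I := I) inferInstance _ fun n ↦ ?_)⟩
  rw [SModEq.sub_mem, sub_zero]
  have h1 := hmul n _ (SModEq.sub_mem.1 (hL n)) (1 - c)
  rw [sub_mul, geom_sum_mul_neg] at h1
  have := Submodule.add_mem _ h1 (hpow n)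
  rw [← Submodule.neg_mem_iff]
  convert this using 1
  abel

lemma IsAdicComplete.smul_top_le_ringJacobson {K A : Type*} [CommRing K] (I : Ideal K)
    [Ring A] [Algebra K A] [IsAdicComplete I A] (c : A) (hc : c ∈ (I • ⊤ : Submodule K A)) :
    c ∈ Ring.jacobson A := by
  rw [← Ideal.jacobson_bot, Ideal.mem_jacobson_iff]
  intro y
  obtain ⟨z, hz⟩ := exists_mul_one_sub_eq_one I (-y * c)
    (Submodule.smul_top_le_comap_smul_top I (LinearMap.mulLeft K (-y)) hc)
  refine ⟨z, ?_⟩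
  rw [Ideal.mem_bot, ← hz]
  noncomm_ring

lemma ModuleCat.isZero_of_finite_of_le_smul_top {K A : Type u} [CommRing K] (I : Ideal K)
    [Ring A] [Algebra K A] [IsAdicComplete I A] (N : ModuleCat.{u} A) [Module.Finite A N]
    (hN : ∀ x : (restrictScalars.{u} (algebraMap K A)).obj N,
      x ∈ (I • ⊤ : Submodule K ((restrictScalars.{u} (algebraMap K A)).obj N))) :
    IsZero N := by
  have h : (⊤ : Submodule A N) = ⊥ := by
    refine Submodule.FG.eq_bot_of_le_jacobson_smul Module.Finite.fg_top fun x _ ↦ ?_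
    refine Submodule.smul_induction_on (hN x) (fun k hk n _ ↦ ?_) fun _ _ h h' ↦ add_mem h h'
    have hk' : algebraMap K A k ∈ Ring.jacobson A := by
      refine IsAdicComplete.smul_top_le_ringJacobson I _ ?_
      rw [Algebra.algebraMap_eq_smul_one]
      exact Submodule.smul_mem_smul hk trivial
    exact Submodule.smul_mem_smul hk' (Submodule.mem_top (x := (show N from n)))
  have : Subsingleton N := (Submodule.subsingleton_iff A).1 (subsingleton_of_bot_eq_top h.symm)
  exact ModuleCat.isZero_of_subsingleton N

/-- **Statement 9.**  Let `K` be a complete noetherian local commutative ring with maximal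
ideal `𝔪` and residue field `𝕜 = K/𝔪`.  Let `A` be an `𝔪`-adically complete `K`-algebra and
let `M` be a perfect complex in `D(Mod A)`.  If `𝕜 ⊗^L_K M = 0`, then `M = 0` in `D(Mod A)`.

Here `M` is represented by a cochain complex of `A`-modules; perfectness means that `M` is
isomorphic in the derived category to a bounded complex of finitely generated projective
`A`-modules; and the derived tensor product `𝕜 ⊗^L_K M` is computed by choosing a bounded
above complex `F` of projective `K`-modules together with a quasi-isomorphism
`F ⟶ M` (as complexes of `K`-modules, via restriction of scalars along `K → A`) and then
applying `𝕜 ⊗[K] -` degreewise; its vanishing is the acyclicity of the resulting complex. -/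
theorem stmt9 (K : Type u) [CommRing K] [IsNoetherianRing K] [IsLocalRing K]
    [IsAdicComplete (IsLocalRing.maximalIdeal K) K]
    (A : Type u) [Ring A] [Algebra K A]
    [IsAdicComplete (IsLocalRing.maximalIdeal K) A]
    [HasDerivedCategory (ModuleCat.{u} A)]
    (M : CochainComplex (ModuleCat.{u} A) ℤ)
    -- `M` is a perfect complex:
    (hperf : ∃ P : CochainComplex (ModuleCat.{u} A) ℤ,
      (∃ a b : ℤ, ∀ i : ℤ, (i < a ∨ b < i) → IsZero (P.X i)) ∧
      (∀ i : ℤ, Projective (P.X i) ∧ Module.Finite A (P.X i)) ∧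
      Nonempty (DerivedCategory.Q.obj M ≅ DerivedCategory.Q.obj P))
    -- `𝕜 ⊗^L_K M = 0`:
    (hvan : ∃ (F : CochainComplex (ModuleCat.{u} K) ℤ)
      (π : F ⟶ ((ModuleCat.restrictScalars.{u} (algebraMap K A)).mapHomologicalComplex
        (ComplexShape.up ℤ)).obj M),
      (∃ n₀ : ℤ, ∀ i : ℤ, n₀ < i → IsZero (F.X i)) ∧
      (∀ i : ℤ, Projective (F.X i)) ∧
      QuasiIso π ∧
      (∀ n : ℤ, IsZero ((((ModuleCat.extendScalars.{u,u}
          (algebraMap K (IsLocalRing.ResidueField K))).mapHomologicalComplex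
          (ComplexShape.up ℤ)).obj F).homology n))) :
    IsZero (DerivedCategory.Q.obj M) := by
  obtain ⟨P, ⟨a, b, hP⟩, hproj, ⟨e⟩⟩ := hperf
  obtain ⟨F, π, ⟨n₀, hF⟩, hFproj, hπ, hFvan⟩ := hvan
  let G := ModuleCat.restrictScalars.{u} (algebraMap K A)
  have hG : G.PreservesHomology :=
    { preservesKernels := fun _ _ f ↦ ModuleCat.preservesLimit_restrictScalars _ _
      preservesCokernels := fun _ _ f ↦ ModuleCat.preservesColimit_restrictScalars _ _ }
  let eP (n : ℤ) : M.homology n ≅ P.homology n :=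
    (DerivedCategory.homologyFunctorFactors (ModuleCat.{u} A) n).symm.app M ≪≫
      (DerivedCategory.homologyFunctor (ModuleCat.{u} A) n).mapIso e ≪≫
      (DerivedCategory.homologyFunctorFactors (ModuleCat.{u} A) n).app P
  let eF (n : ℤ) : F.homology n ≅ G.obj (M.homology n) :=
    asIso (HomologicalComplex.homologyMap π n) ≪≫ (M.sc n).mapHomologyIso G
  have key (k : ℕ) : ∀ n : ℤ, b < n + k → IsZero (M.homology n) := by
    induction k with
    | zero =>
      intro n hn
      refine IsZero.of_iso ?_ (eP n)
      exact (HomologicalComplex.ExactAt.of_isZero (hP n (Or.inr (by simpa using hn)))).isZero_homology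
    | succ k ih =>
      intro n hn
      have hM (i : ℤ) (hi : n < i) : IsZero (M.homology i) :=
        ih i (by push_cast at hn; omega)
      have hrel : (ComplexShape.up ℤ).Rel n ((ComplexShape.up ℤ).next n) := by simp
      obtain ⟨r, hr, hr'⟩ := P.exists_retraction_cycles b n (fun i hi ↦ hP i (Or.inr hi))
        (fun i ↦ (hproj i).1)
        (fun i hi ↦ (P.exactAt_iff_isZero_homology i).2 ((hM i hi).of_iso (eP i).symm)) n _ hrel
        le_rfl
      obtain ⟨s, hs, hs'⟩ := F.exists_retraction_cycles n₀ n hF hFproj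
        (fun i hi ↦ (F.exactAt_iff_isZero_homology i).2
          ((G.map_isZero (hM i hi)).of_iso (eF i))) n _ hrel le_rfl
      have : Module.Finite A (P.sc n).X₂ := (hproj n).2
      have hfin : Module.Finite A (P.homology n) := (P.sc n).moduleCat_homology_finite r hr hr'
      have : Module.Finite A (M.homology n) := Module.Finite.equiv (eP n).symm.toLinearEquiv
      have hFn := (F.sc n).homology_le_smul_top s hs hs'
        ((ShortComplex.exact_iff_isZero_homology _).2 (hFvan n))
      refine ModuleCat.isZero_of_finite_of_le_smul_top (IsLocalRing.maximalIdeal K) _ fun x ↦ ?_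
      obtain ⟨y, rfl⟩ := (eF n).toLinearEquiv.surjective x
      exact Submodule.smul_top_le_comap_smul_top _ (eF n).toLinearEquiv.toLinearMap (hFn y)
  let Z : CochainComplex (ModuleCat.{u} A) ℤ := HomologicalComplex.zero
  have hZ : IsZero Z := HomologicalComplex.isZero_zero
  have h0 : QuasiIso (0 : M ⟶ Z) := by
    rw [quasiIso_iff]
    intro n
    rw [quasiIsoAt_iff_isIso_homologyMap]
    have h1 : IsZero (M.homology n) := key (b + 1 - n).toNat n (by omega)
    have h2 : IsZero (Z.homology n) :=
      (HomologicalComplex.homologyFunctor _ _ n).map_isZero hZ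
    exact ⟨0, h1.eq_of_src _ _, h2.eq_of_src _ _⟩
  exact (DerivedCategory.Q.map_isZero hZ).of_iso (asIso (DerivedCategory.Q.map (0 : M ⟶ Z)))
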